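/- arXiv:2108.02900 — 2 statements merged into one kernel-verified Lean document; each statement's English description precedes it below -/
import Mathlib

section
/- (Hardy's inequality in dimension 2, fractional form) Let 0 < s < 1. There exists a constant C > 0 such that for all u in the Schwartz space on ℝ², the L² norm of |x|^{-s} u(x) is at most C times the L² norm of ⟨D⟩^s u, where ⟨D⟩^s is the Fourier multiplier with symbol (1 + 4π²|ξ|²)^{s/2}. Equivalently, the operator |x|^{-s}⟨D⟩^{-s} extends to a bounded operator on L²(ℝ²). -/
open MeasureTheory Real FourierTransform SchwartzMap
noncomputable section

/-- The Bessel-type Fourier multiplier `⟨D⟩ˢ` with symbol `(1 + 4π²|ξ|²)^(s/2)`. -/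
def JapD (s : ℝ) (f : EuclideanSpace ℝ (Fin 2) → ℂ) : EuclideanSpace ℝ (Fin 2) → ℂ :=
  𝓕⁻ (fun ξ => (((1 + 4 * π ^ 2 * ‖ξ‖ ^ 2) ^ (s / 2) : ℝ) : ℂ) * 𝓕 f ξ)

local notation "E2" => EuclideanSpace ℝ (Fin 2)

lemma sq_integrable (f : 𝓢(E2, ℂ)) : Integrable (fun x => ‖f x‖ ^ 2) := by
  have := (f.memLp 2 volume).integrable_norm_rpow (by simp) (by simp)
  simpa using this

lemma planch (f : 𝓢(E2, ℂ)) :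
    ∫⁻ ξ, ENNReal.ofReal (‖𝓕 f ξ‖ ^ 2) = ∫⁻ x, ENNReal.ofReal (‖f x‖ ^ 2) := by
  rw [← ofReal_integral_eq_lintegral_ofReal (sq_integrable _) (.of_forall fun _ => by positivity),
    ← ofReal_integral_eq_lintegral_ofReal (sq_integrable _) (.of_forall fun _ => by positivity),
    integral_norm_sq_fourier]

lemma eLp2 (f : E2 → ℂ) :
    eLpNorm f 2 volume = (∫⁻ x, ENNReal.ofReal (‖f x‖ ^ 2)) ^ (1 / 2 : ℝ) := by
  rw [eLpNorm_eq_lintegral_rpow_enorm_toReal (by simp) (by simp)]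
  congr 1
  apply lintegral_congr
  intro x
  rw [ENNReal.ofReal_pow (norm_nonneg _), ofReal_norm]
  simp

lemma tg (s : ℝ) : (fun ξ : E2 => (((1 + 4 * π ^ 2 * ‖ξ‖ ^ 2) ^ (s / 2) : ℝ) : ℂ)).HasTemperateGrowth := by
  have h1 := Function.hasTemperateGrowth_one_add_norm_sq_rpow E2 (s / 2)
  have h2 : (fun ξ : E2 => (2 * π) • ξ).HasTemperateGrowth := by fun_prop
  have h3 := (Function.Complex.hasTemperateGrowth_ofReal).comp (h1.comp h2)
  have e : ∀ ξ : E2, ‖(2 * π) • ξ‖ ^ 2 = 4 * π ^ 2 * ‖ξ‖ ^ 2 := by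
    intro ξ
    rw [norm_smul, norm_of_nonneg (by positivity)]; ring
  simp only [Function.comp_def, e] at h3
  exact h3

lemma japd (s : ℝ) (u : 𝓢(E2, ℂ)) :
    ∫⁻ x, ENNReal.ofReal (‖JapD s u x‖ ^ 2) =
      ∫⁻ ξ : E2, ENNReal.ofReal ((1 + 4 * π ^ 2 * ‖ξ‖ ^ 2) ^ s) * ENNReal.ofReal (‖𝓕 u ξ‖ ^ 2) := by
  set v : 𝓢(E2, ℂ) := smulLeftCLM ℂ (fun ξ : E2 => (((1 + 4 * π ^ 2 * ‖ξ‖ ^ 2) ^ (s / 2) : ℝ) : ℂ)) (𝓕 u) with hv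
  have h1 : JapD s u = (𝓕⁻ v : 𝓢(E2, ℂ)) := by
    rw [fourierInv_coe, hv, smulLeftCLM_apply (tg s)]
    rfl
  rw [h1, ← planch, fourier_fourierInv_eq]
  apply lintegral_congr
  intro ξ
  have : (0:ℝ) < 1 + 4 * π ^ 2 * ‖ξ‖ ^ 2 := by positivity
  rw [hv, smulLeftCLM_apply_apply (tg s), ← ENNReal.ofReal_mul (by positivity), norm_smul, mul_pow,
    Complex.norm_real, norm_of_nonneg (by positivity), ← rpow_natCast, ← rpow_mul this.le]
  norm_num

lemma shiftF (u : 𝓢(E2, ℂ)) (h : E2) :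
    ∫⁻ x, ENNReal.ofReal (‖u (x + h) - u x‖ ^ 2) ≤
      ∫⁻ ξ : E2, ENNReal.ofReal (min 4 ((1 + 4 * π ^ 2 * ‖ξ‖ ^ 2) * ‖h‖ ^ 2)) * ENNReal.ofReal (‖𝓕 u ξ‖ ^ 2) := by
  set v : 𝓢(E2, ℂ) := compSubConstCLM ℂ (-h) u - u with hv
  have h1 : ∀ x, v x = u (x + h) - u x := by
    intro x; simp [hv, sub_apply, compSubConstCLM_apply]
  have h2 : ∀ ξ, 𝓕 v ξ = (Complex.exp (Complex.I * (2 * π * inner ℝ h ξ : ℝ)) - 1) * 𝓕 u ξ := by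
    intro ξ
    have e1 : 𝓕 v = 𝓕 (compSubConstCLM ℂ (-h) u) - 𝓕 u := by
      rw [hv]; exact map_sub (fourierCLM ℂ 𝓢(E2, ℂ)) _ _
    rw [e1, sub_apply, sub_mul, one_mul]
    congr 1
    have e2 : ((compSubConstCLM ℂ (-h) u : 𝓢(E2, ℂ)) : E2 → ℂ) = (u : E2 → ℂ) ∘ fun x => x + h := by
      ext x; simp [compSubConstCLM_apply]
    rw [fourier_coe, e2, fourier_coe]
    have := congrFun (VectorFourier.fourierIntegral_comp_add_right Real.fourierChar volume (innerₗ E2) (u : E2 → ℂ) h) ξ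
    refine this.trans ?_
    rw [Circle.smul_def, Real.fourierChar_apply, smul_eq_mul]
    simp [mul_comm]
    rfl
  simp_rw [← h1]
  rw [← planch]
  apply lintegral_mono
  intro ξ
  dsimp only
  rw [h2, ← ENNReal.ofReal_mul (by positivity), norm_mul, mul_pow]
  apply ENNReal.ofReal_le_ofReal
  gcongr
  apply le_min
  · have : ‖Complex.exp (Complex.I * (2 * π * inner ℝ h ξ : ℝ)) - 1‖ ≤ 2 := by
      refine (norm_sub_le _ _).trans ?_
      rw [mul_comm, Complex.norm_exp_ofReal_mul_I]; norm_num
    nlinarith [norm_nonneg (Complex.exp (Complex.I * (2 * π * inner ℝ h ξ : ℝ)) - 1)]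
  · have := Real.norm_exp_I_mul_ofReal_sub_one_le (x := 2 * π * inner ℝ h ξ)
    have h4 : ‖2 * π * inner ℝ h ξ‖ ≤ 2 * π * (‖h‖ * ‖ξ‖) := by
      rw [norm_mul, norm_of_nonneg (by positivity)]
      gcongr; exact norm_inner_le_norm _ _
    calc _ ≤ (2 * π * (‖h‖ * ‖ξ‖)) ^ 2 := by gcongr; exact this.trans h4
      _ ≤ _ := by nlinarith [sq_nonneg ‖h‖]

lemma Jfin (s : ℝ) (hs0 : 0 < s) (hs1 : s < 1) :
    ∫⁻ k : E2, ENNReal.ofReal (min 4 (‖k‖ ^ 2) * ‖k‖ ^ (-2 - 2 * s)) ≠ ⊤ := by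
  have m : Measurable (fun k : E2 => min 4 (‖k‖ ^ 2) * ‖k‖ ^ (-2 - 2 * s)) := by fun_prop
  have f2 : Module.finrank ℝ E2 = 2 := by simp
  have i1 : IntegrableOn (fun k : E2 => min 4 (‖k‖ ^ 2) * ‖k‖ ^ (-2 - 2 * s)) (Metric.ball 0 1) := by
    apply integrableOn_ball_of_norm_le_rpow (C := 1) (α := 2 * s) (by simp) (by rw [f2]; norm_num; linarith) _ m.aestronglyMeasurable
    refine .of_forall fun x => ?_
    rcases (norm_nonneg x).eq_or_lt with h | h
    · rw [← h, zero_rpow (by linarith), mul_zero, norm_zero]; positivity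
    rw [norm_of_nonneg (by positivity)]
    calc _ ≤ ‖x‖ ^ 2 * ‖x‖ ^ (-2 - 2 * s) := by gcongr; exact min_le_right _ _
      _ = _ := by rw [← rpow_natCast, ← rpow_add h]; ring_nf
  have i2 : IntegrableOn (fun k : E2 => min 4 (‖k‖ ^ 2) * ‖k‖ ^ (-2 - 2 * s)) (Metric.ball 0 1)ᶜ := by
    have := ((integrable_one_add_norm (E := E2) (μ := volume) (r := 2 + 2 * s) (by rw [f2]; norm_num; linarith)).const_mul (4 * 2 ^ (2 + 2 * s))).integrableOn (s := (Metric.ball 0 1)ᶜ)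
    refine this.mono' m.aestronglyMeasurable ?_
    refine ae_restrict_of_forall_mem (Metric.isOpen_ball.measurableSet.compl) fun x hx => ?_
    have hx : 1 ≤ ‖x‖ := by simpa using hx
    have h0 : 0 < ‖x‖ := by linarith
    rw [norm_of_nonneg (by positivity), mul_assoc]
    gcongr
    · exact min_le_left _ _
    · have : (2:ℝ) ^ (2 + 2 * s) = (1/2:ℝ) ^ (-(2 + 2 * s)) := by
        rw [rpow_neg (by norm_num), one_div, inv_rpow (by norm_num), inv_inv]
      rw [this, ← mul_rpow (by norm_num) (by positivity), show -2 - 2 * s = -(2 + 2 * s) by ring]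
      apply rpow_le_rpow_of_nonpos (by positivity) _ (by linarith)
      linarith
  have i := i1.union i2
  rw [Set.union_compl_self, integrableOn_univ] at i
  exact i.lintegral_lt_top.ne

lemma Jscale (s a : ℝ) (ha : 0 < a) :
    ∫⁻ h : E2, ENNReal.ofReal (min 4 (a ^ 2 * ‖h‖ ^ 2) * ‖h‖ ^ (-2 - 2 * s)) =
      ENNReal.ofReal (a ^ (2 * s)) * ∫⁻ k : E2, ENNReal.ofReal (min 4 (‖k‖ ^ 2) * ‖k‖ ^ (-2 - 2 * s)) := by
  set g : E2 → ENNReal := fun k => ENNReal.ofReal (min 4 (‖k‖ ^ 2) * ‖k‖ ^ (-2 - 2 * s))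
  have m : Measurable g := by fun_prop
  have h1 : ∀ h : E2, ENNReal.ofReal (min 4 (a ^ 2 * ‖h‖ ^ 2) * ‖h‖ ^ (-2 - 2 * s)) =
      ENNReal.ofReal (a ^ (2 + 2 * s)) * g (a • h) := by
    intro h
    simp only [g]
    rw [← ENNReal.ofReal_mul (by positivity), norm_smul, norm_of_nonneg ha.le, mul_rpow ha.le (norm_nonneg _),
      mul_pow]
    congr 1
    have : a ^ (2 + 2 * s) * a ^ (-2 - 2 * s) = 1 := by
      rw [← rpow_add ha]; ring_nf; simp
    linear_combination (-(min 4 (a ^ 2 * ‖h‖ ^ 2) * ‖h‖ ^ (-2 - 2 * s))) * this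
  simp_rw [h1]
  rw [lintegral_const_mul _ (by fun_prop), ← lintegral_map (μ := volume) m (measurable_const_smul a),
    Measure.map_addHaar_smul _ ha.ne', lintegral_smul_measure, smul_eq_mul, ← mul_assoc, ← ENNReal.ofReal_mul (by positivity)]
  congr 2
  rw [abs_of_pos (by positivity), rpow_add ha]
  simp
  field_simp

lemma gagl (s : ℝ) (u : 𝓢(E2, ℂ)) :
    ∫⁻ h : E2, ENNReal.ofReal (‖h‖ ^ (-2 - 2 * s)) * ∫⁻ x, ENNReal.ofReal (‖u (x + h) - u x‖ ^ 2) ≤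
      (∫⁻ k : E2, ENNReal.ofReal (min 4 (‖k‖ ^ 2) * ‖k‖ ^ (-2 - 2 * s))) *
      ∫⁻ ξ : E2, ENNReal.ofReal ((1 + 4 * π ^ 2 * ‖ξ‖ ^ 2) ^ s) * ENNReal.ofReal (‖𝓕 u ξ‖ ^ 2) := by
  have mu : Measurable (fun ξ => 𝓕 u ξ) := (𝓕 u).continuous.measurable
  calc _ ≤ ∫⁻ h : E2, ENNReal.ofReal (‖h‖ ^ (-2 - 2 * s)) * ∫⁻ ξ : E2, ENNReal.ofReal (min 4 ((1 + 4 * π ^ 2 * ‖ξ‖ ^ 2) * ‖h‖ ^ 2)) * ENNReal.ofReal (‖𝓕 u ξ‖ ^ 2) := by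
        exact lintegral_mono fun h => mul_le_mul_right (shiftF u h) _
    _ = ∫⁻ h : E2, ∫⁻ ξ : E2, ENNReal.ofReal (‖h‖ ^ (-2 - 2 * s)) * (ENNReal.ofReal (min 4 ((1 + 4 * π ^ 2 * ‖ξ‖ ^ 2) * ‖h‖ ^ 2)) * ENNReal.ofReal (‖𝓕 u ξ‖ ^ 2)) := by
        congr with h; rw [lintegral_const_mul _ (by fun_prop)]
    _ = ∫⁻ ξ : E2, ∫⁻ h : E2, ENNReal.ofReal (‖h‖ ^ (-2 - 2 * s)) * (ENNReal.ofReal (min 4 ((1 + 4 * π ^ 2 * ‖ξ‖ ^ 2) * ‖h‖ ^ 2)) * ENNReal.ofReal (‖𝓕 u ξ‖ ^ 2)) := by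
        apply lintegral_lintegral_swap
        apply Measurable.aemeasurable
        unfold Function.uncurry
        fun_prop
    _ = _ := by
        rw [← lintegral_const_mul _ (by fun_prop)]
        congr with ξ
        have hp : (0:ℝ) < 1 + 4 * π ^ 2 * ‖ξ‖ ^ 2 := by positivity
        have := Jscale s (√(1 + 4 * π ^ 2 * ‖ξ‖ ^ 2)) (by positivity)
        rw [sq_sqrt hp.le, sqrt_eq_rpow, ← rpow_mul hp.le, show 1 / 2 * (2 * s) = s by ring] at this
        rw [← mul_assoc, mul_comm (∫⁻ k : E2, _), ← this, ← lintegral_mul_const _ (by fun_prop)]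
        congr with h
        rw [← mul_assoc, ← ENNReal.ofReal_mul (by positivity), mul_comm (‖h‖ ^ _)]

def chi (R : ℝ) (x h : E2) : ENNReal :=
  Set.indicator {p : E2 × E2 | R * ‖p.1‖ ≤ ‖p.2‖ ∧ ‖p.2‖ ≤ 2 * R * ‖p.1‖} 1 (x, h)

lemma chi_meas (R : ℝ) : Measurable (fun p : E2 × E2 => chi R p.1 p.2) := by
  unfold chi
  apply Measurable.indicator measurable_one
  have m1 : Measurable fun p : E2 × E2 => R * ‖p.1‖ := by fun_prop
  have m2 : Measurable fun p : E2 × E2 => ‖p.2‖ := by fun_prop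
  have m3 : Measurable fun p : E2 × E2 => 2 * R * ‖p.1‖ := by fun_prop
  exact (measurableSet_le m1 m2).inter (measurableSet_le m2 m3)

lemma chi_meas2 (R : ℝ) {α : Type} [MeasurableSpace α] {f g : α → E2} (hf : Measurable f) (hg : Measurable g) :
    Measurable (fun a => chi R (f a) (g a)) :=
  Measurable.comp (g := fun p : E2 × E2 => chi R p.1 p.2) (f := fun a => (f a, g a)) (chi_meas R) (hf.prodMk hg)

lemma chi_le_one (R : ℝ) (x h : E2) : chi R x h ≤ 1 := by
  unfold chi
  exact Set.indicator_le_self _ _ _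

lemma chi_lower (s R : ℝ) (hs0 : 0 < s) (hs1 : s < 1) (hR : 3 ≤ R) (x : E2) (hx : x ≠ 0) :
    ENNReal.ofReal (R ^ (-2 * s) / 2) * ENNReal.ofReal (‖x‖ ^ (-2 * s)) ≤
      ∫⁻ h : E2, chi R x h * ENNReal.ofReal (‖h‖ ^ (-2 - 2 * s)) := by
  have hx0 : 0 < ‖x‖ := norm_pos_iff.2 hx
  have hR0 : 0 < R := by linarith
  set T : Set E2 := Metric.closedBall 0 (2 * R * ‖x‖) \ Metric.ball 0 (R * ‖x‖) with hT
  have mT : MeasurableSet T := Metric.isClosed_closedBall.measurableSet.diff Metric.isOpen_ball.measurableSet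
  have hmem : ∀ h, h ∈ T ↔ ‖h‖ ≤ 2 * R * ‖x‖ ∧ R * ‖x‖ ≤ ‖h‖ := by intro h; simp [hT]
  have hv : volume T = ENNReal.ofReal (3 * π * (R * ‖x‖) ^ 2) := by
    rw [hT, measure_sdiff ((Metric.ball_subset_closedBall).trans (Metric.closedBall_subset_closedBall (by nlinarith)))
      Metric.isOpen_ball.measurableSet.nullMeasurableSet (by finiteness),
      EuclideanSpace.volume_ball_fin_two, EuclideanSpace.volume_closedBall_fin_two,
      ← ENNReal.ofReal_pow (by positivity), ← ENNReal.ofReal_pow (by positivity), ← ENNReal.ofReal_mul (by positivity),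
      ← ENNReal.ofReal_mul (by positivity), ← ENNReal.ofReal_sub _ (by positivity)]
    congr 1; ring
  calc _ ≤ ENNReal.ofReal ((2 * R * ‖x‖) ^ (-2 - 2 * s)) * volume T := by
        rw [hv, ← ENNReal.ofReal_mul (by positivity), ← ENNReal.ofReal_mul (by positivity)]
        apply ENNReal.ofReal_le_ofReal
        have e1 : (2 * R * ‖x‖) ^ (-2 - 2 * s) = 2 ^ (-2 - 2 * s) * ((R * ‖x‖) ^ 2)⁻¹ * (R ^ (-2 * s) * ‖x‖ ^ (-2 * s)) := by
          rw [mul_assoc, mul_rpow (by norm_num) (by positivity), ← mul_rpow hR0.le hx0.le, mul_assoc]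
          congr 1
          rw [← rpow_natCast, ← rpow_neg (by positivity), ← rpow_add (by positivity)]
          congr 1; push_cast; ring
        have e2 : (1/16 : ℝ) ≤ 2 ^ (-2 - 2 * s) := by
          calc (1/16:ℝ) = 2 ^ (-4 : ℝ) := by rw [rpow_neg (by norm_num)]; norm_num
            _ ≤ _ := by apply rpow_le_rpow_of_exponent_le (by norm_num); linarith
        rw [e1]
        have e3 : 2 ^ (-2 - 2 * s) * ((R * ‖x‖) ^ 2)⁻¹ * (R ^ (-2 * s) * ‖x‖ ^ (-2 * s)) * (3 * π * (R * ‖x‖) ^ 2) =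
          2 ^ (-2 - 2 * s) * (3 * π) * (R ^ (-2 * s) * ‖x‖ ^ (-2 * s)) := by field_simp
        rw [e3]
        have e4 : (1/2 : ℝ) ≤ 2 ^ (-2 - 2 * s) * (3 * π) := by nlinarith [pi_gt_three]
        have := mul_le_mul_of_nonneg_right e4 (show 0 ≤ R ^ (-2 * s) * ‖x‖ ^ (-2 * s) by positivity)
        linarith
    _ = ∫⁻ h in T, ENNReal.ofReal ((2 * R * ‖x‖) ^ (-2 - 2 * s)) := by rw [setLIntegral_const]
    _ ≤ ∫⁻ h in T, chi R x h * ENNReal.ofReal (‖h‖ ^ (-2 - 2 * s)) := by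
        apply setLIntegral_mono' mT
        intro h hh
        rw [hmem] at hh
        have : chi R x h = 1 := by
          unfold chi; rw [Set.indicator_of_mem]; rfl; exact ⟨hh.2, hh.1⟩
        rw [this, one_mul]
        apply ENNReal.ofReal_le_ofReal
        have : 0 < ‖h‖ := lt_of_lt_of_le (by positivity) hh.2
        exact rpow_le_rpow_of_nonpos this hh.1 (by linarith)
    _ ≤ _ := setLIntegral_le_lintegral _ _

lemma chi_upper (s R : ℝ) (hs0 : 0 < s) (hs1 : s < 1) (hR : 3 ≤ R) (y : E2) (hy : y ≠ 0) :
    ∫⁻ x : E2, chi R x (y - x) * ENNReal.ofReal (‖y - x‖ ^ (-2 - 2 * s)) ≤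
    ENNReal.ofReal (64 * π * R ^ (-2 : ℝ)) * ENNReal.ofReal (‖y‖ ^ (-2 * s)) := by
  have hy0 : 0 < ‖y‖ := norm_pos_iff.2 hy
  have hR0 : 0 < R := by linarith
  set T : Set E2 := Metric.closedBall 0 (2 * R⁻¹ * ‖y‖) with hT
  have mT : MeasurableSet T := Metric.isClosed_closedBall.measurableSet
  calc _ ≤ ∫⁻ x, T.indicator (fun _ => ENNReal.ofReal (16 * ‖y‖ ^ (-2 - 2 * s))) x := by
        apply lintegral_mono
        intro x
        dsimp only
        by_cases hh : R * ‖x‖ ≤ ‖y - x‖ ∧ ‖y - x‖ ≤ 2 * R * ‖x‖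
        · have n1 : ‖y - x‖ ≤ ‖y‖ + ‖x‖ := norm_sub_le _ _
          have n2 : ‖y‖ - ‖x‖ ≤ ‖y - x‖ := norm_sub_norm_le _ _
          have n3 : 2 * ‖x‖ ≤ ‖y‖ := by nlinarith [norm_nonneg x]
          have hx : x ∈ T := by
            rw [hT, mem_closedBall_zero_iff]
            have : R * ‖x‖ ≤ 2 * ‖y‖ := by nlinarith [norm_nonneg x]
            rw [mul_assoc, mul_comm R⁻¹, ← mul_assoc, ← div_eq_mul_inv, le_div_iff₀ hR0]; linarith
          have : chi R x (y - x) ≤ 1 := by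
            unfold chi; exact Set.indicator_le_self _ _ _
          rw [Set.indicator_of_mem hx]
          refine (mul_le_of_le_one_left' this).trans ?_
          apply ENNReal.ofReal_le_ofReal
          calc ‖y - x‖ ^ (-2 - 2 * s) ≤ (2⁻¹ * ‖y‖) ^ (-2 - 2 * s) := by
                apply rpow_le_rpow_of_nonpos (by positivity) (by linarith) (by linarith)
            _ = 2 ^ (2 + 2 * s) * ‖y‖ ^ (-2 - 2 * s) := by
                rw [mul_rpow (by norm_num) (by positivity), inv_rpow (by norm_num), ← rpow_neg (by norm_num)]
                congr 2; ring
            _ ≤ 2 ^ (4 : ℝ) * ‖y‖ ^ (-2 - 2 * s) := by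
                gcongr
                · norm_num
                · linarith
            _ = _ := by norm_num
        · have : chi R x (y - x) = 0 := by
            unfold chi; rw [Set.indicator_of_notMem]; exact hh
          rw [this, zero_mul]; exact zero_le
    _ = ENNReal.ofReal (16 * ‖y‖ ^ (-2 - 2 * s)) * volume T := by rw [lintegral_indicator_const mT]
    _ = _ := by
        rw [hT, EuclideanSpace.volume_closedBall_fin_two, ← ENNReal.ofReal_pow (by positivity), ← ENNReal.ofReal_mul (by positivity),
         ← ENNReal.ofReal_mul (by positivity), ← ENNReal.ofReal_mul (by positivity)]
        congr 1
        rw [sub_eq_add_neg, rpow_add hy0, rpow_neg hR0.le, rpow_neg hy0.le]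
        norm_num
        field_simp
        norm_num

lemma ae_nz : ∀ᵐ x : E2, x ≠ 0 := by
  simp [ae_iff, measure_singleton]

lemma real_aux (a b c : ℝ) (ha : 0 ≤ a) (h : a ≤ b + c) :
    a ^ 2 ≤ 2 * (b ^ 2 + c ^ 2) := by
  have : a ^ 2 ≤ (b + c) ^ 2 := pow_le_pow_left₀ ha h 2
  nlinarith [sq_nonneg (b - c)]

lemma hpt_aux (u : E2 → ℂ) (x h : E2) :
    ENNReal.ofReal (‖u x‖ ^ 2) ≤
      2 * ENNReal.ofReal (‖u (x + h) - u x‖ ^ 2) + 2 * ENNReal.ofReal (‖u (x + h)‖ ^ 2) := by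
  have t2 : ∀ r : ℝ, 2 * ENNReal.ofReal r = ENNReal.ofReal (2 * r) := by
    intro r; rw [ENNReal.ofReal_mul (by norm_num)]; simp
  rw [← mul_add, ← ENNReal.ofReal_add (by positivity) (by positivity), t2]
  apply ENNReal.ofReal_le_ofReal
  apply real_aux _ _ _ (norm_nonneg _)
  have := norm_sub_le (u (x + h)) (u (x + h) - u x)
  rw [sub_sub_cancel] at this
  linarith

def Wt (s : ℝ) (h : E2) : ENNReal := ENNReal.ofReal (‖h‖ ^ (-2 - 2 * s))

lemma Wt_meas (s : ℝ) : Measurable (Wt s) := by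
  unfold Wt; fun_prop

lemma key1 (s R : ℝ) (hs0 : 0 < s) (hs1 : s < 1) (hR : 3 ≤ R) (u : E2 → ℂ) (mu : Measurable u) :
    ENNReal.ofReal (R ^ (-2 * s) / 2) * (∫⁻ x : E2, ENNReal.ofReal (‖x‖ ^ (-2 * s)) * ENNReal.ofReal (‖u x‖ ^ 2)) =
      (∫⁻ x : E2, ENNReal.ofReal (R ^ (-2 * s) / 2) * ENNReal.ofReal (‖x‖ ^ (-2 * s)) * ENNReal.ofReal (‖u x‖ ^ 2)) := by
  rw [← lintegral_const_mul _ (by fun_prop)]; simp_rw [mul_assoc]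

lemma key2 (s R : ℝ) (hs0 : 0 < s) (hs1 : s < 1) (hR : 3 ≤ R) (u : E2 → ℂ) (mu : Measurable u) :
    (∫⁻ x : E2, ENNReal.ofReal (R ^ (-2 * s) / 2) * ENNReal.ofReal (‖x‖ ^ (-2 * s)) * ENNReal.ofReal (‖u x‖ ^ 2)) ≤
      (∫⁻ x : E2, ∫⁻ h : E2, (2 * (Wt s h * ENNReal.ofReal (‖u (x + h) - u x‖ ^ 2)) + 2 * (chi R x h * Wt s h * ENNReal.ofReal (‖u (x + h)‖ ^ 2)))) := by
  have mc := chi_meas R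
  have ae0 := ae_nz
  have hpt := hpt_aux u
  have mW := Wt_meas s
  have chile := chi_le_one R
  have mc1 : ∀ x, Measurable (fun h => chi R x h) := fun x => chi_meas2 R (by fun_prop) (by fun_prop)
  have mc2 : Measurable (fun p : E2 × E2 => chi R p.1 (p.2 - p.1)) := chi_meas2 R (by fun_prop) (by fun_prop)
  have mc3 : ∀ y, Measurable (fun x => chi R x (y - x)) := fun y => chi_meas2 R (by fun_prop) (by fun_prop)
  apply lintegral_mono_ae
  filter_upwards [ae0] with x hx
  refine (mul_le_mul_left (chi_lower s R hs0 hs1 hR x hx) _).trans ?_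
  have mx := mc1 x
  rw [← lintegral_mul_const _ (by fun_prop)]
  apply lintegral_mono
  intro h
  calc chi R x h * Wt s h * ENNReal.ofReal (‖u x‖ ^ 2) ≤ chi R x h * Wt s h * (2 * ENNReal.ofReal (‖u (x + h) - u x‖ ^ 2) + 2 * ENNReal.ofReal (‖u (x + h)‖ ^ 2)) := by
        gcongr; exact hpt x h
    _ = 2 * (chi R x h * Wt s h * ENNReal.ofReal (‖u (x + h) - u x‖ ^ 2)) + 2 * (chi R x h * Wt s h * ENNReal.ofReal (‖u (x + h)‖ ^ 2)) := by ring
    _ ≤ _ := by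
        refine add_le_add (mul_le_mul_right ?_ 2) le_rfl
        exact mul_le_mul_left (mul_le_of_le_one_left' (chile x h)) _

lemma key3 (s R : ℝ) (hs0 : 0 < s) (hs1 : s < 1) (hR : 3 ≤ R) (u : E2 → ℂ) (mu : Measurable u) :
    (∫⁻ x : E2, ∫⁻ h : E2, (2 * (Wt s h * ENNReal.ofReal (‖u (x + h) - u x‖ ^ 2)) + 2 * (chi R x h * Wt s h * ENNReal.ofReal (‖u (x + h)‖ ^ 2)))) =
      2 * (∫⁻ x : E2, ∫⁻ h : E2, Wt s h * ENNReal.ofReal (‖u (x + h) - u x‖ ^ 2)) + 2 * (∫⁻ x : E2, ∫⁻ h : E2, chi R x h * Wt s h * ENNReal.ofReal (‖u (x + h)‖ ^ 2)) := by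
  have mc := chi_meas R
  have ae0 := ae_nz
  have hpt := hpt_aux u
  have mW := Wt_meas s
  have chile := chi_le_one R
  have mc1 : ∀ x, Measurable (fun h => chi R x h) := fun x => chi_meas2 R (by fun_prop) (by fun_prop)
  have mc2 : Measurable (fun p : E2 × E2 => chi R p.1 (p.2 - p.1)) := chi_meas2 R (by fun_prop) (by fun_prop)
  have mc3 : ∀ y, Measurable (fun x => chi R x (y - x)) := fun y => chi_meas2 R (by fun_prop) (by fun_prop)
  rw [← lintegral_const_mul _ (Measurable.lintegral_prod_right' (f := fun p : E2 × E2 => Wt s p.2 * ENNReal.ofReal (‖u (p.1 + p.2) - u p.1‖ ^ 2)) (by fun_prop)),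
    ← lintegral_const_mul _ (Measurable.lintegral_prod_right' (f := fun p : E2 × E2 => chi R p.1 p.2 * Wt s p.2 * ENNReal.ofReal (‖u (p.1 + p.2)‖ ^ 2)) (by fun_prop)),
    ← lintegral_add_left (Measurable.const_mul (Measurable.lintegral_prod_right' (f := fun p : E2 × E2 => Wt s p.2 * ENNReal.ofReal (‖u (p.1 + p.2) - u p.1‖ ^ 2)) (by fun_prop)) _)]
  congr with x
  have := mc1 x
  rw [lintegral_add_left (by fun_prop), lintegral_const_mul _ (by fun_prop), lintegral_const_mul _ (by fun_prop)]

lemma key4 (s R : ℝ) (hs0 : 0 < s) (hs1 : s < 1) (hR : 3 ≤ R) (u : E2 → ℂ) (mu : Measurable u) :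
    (∫⁻ x : E2, ∫⁻ h : E2, Wt s h * ENNReal.ofReal (‖u (x + h) - u x‖ ^ 2)) ≤ (∫⁻ h : E2, Wt s h * ∫⁻ x, ENNReal.ofReal (‖u (x + h) - u x‖ ^ 2)) := by
  have mc := chi_meas R
  have ae0 := ae_nz
  have hpt := hpt_aux u
  have mW := Wt_meas s
  have chile := chi_le_one R
  have mc1 : ∀ x, Measurable (fun h => chi R x h) := fun x => chi_meas2 R (by fun_prop) (by fun_prop)
  have mc2 : Measurable (fun p : E2 × E2 => chi R p.1 (p.2 - p.1)) := chi_meas2 R (by fun_prop) (by fun_prop)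
  have mc3 : ∀ y, Measurable (fun x => chi R x (y - x)) := fun y => chi_meas2 R (by fun_prop) (by fun_prop)
  rw [lintegral_lintegral_swap (by apply Measurable.aemeasurable; unfold Function.uncurry; fun_prop)]
  apply lintegral_mono
  intro h
  dsimp only
  rw [lintegral_const_mul _ (by fun_prop)]

lemma key5 (s R : ℝ) (hs0 : 0 < s) (hs1 : s < 1) (hR : 3 ≤ R) (u : E2 → ℂ) (mu : Measurable u) :
    (∫⁻ x : E2, ∫⁻ h : E2, chi R x h * Wt s h * ENNReal.ofReal (‖u (x + h)‖ ^ 2)) ≤ ENNReal.ofReal (64 * π * R ^ (-2 : ℝ)) * (∫⁻ x : E2, ENNReal.ofReal (‖x‖ ^ (-2 * s)) * ENNReal.ofReal (‖u x‖ ^ 2)) := by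
  have mc := chi_meas R
  have ae0 := ae_nz
  have hpt := hpt_aux u
  have mW := Wt_meas s
  have chile := chi_le_one R
  have mc1 : ∀ x, Measurable (fun h => chi R x h) := fun x => chi_meas2 R (by fun_prop) (by fun_prop)
  have mc2 : Measurable (fun p : E2 × E2 => chi R p.1 (p.2 - p.1)) := chi_meas2 R (by fun_prop) (by fun_prop)
  have mc3 : ∀ y, Measurable (fun x => chi R x (y - x)) := fun y => chi_meas2 R (by fun_prop) (by fun_prop)
  have e : ∀ x : E2, ∫⁻ h : E2, chi R x h * Wt s h * ENNReal.ofReal (‖u (x + h)‖ ^ 2) =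
      ∫⁻ y : E2, chi R x (y - x) * Wt s (y - x) * ENNReal.ofReal (‖u y‖ ^ 2) := by
    intro x
    conv_rhs => rw [← lintegral_add_left_eq_self _ x]
    simp only [add_sub_cancel_left]
  simp_rw [e]
  rw [lintegral_lintegral_swap (by apply Measurable.aemeasurable; unfold Function.uncurry; fun_prop),
    ← lintegral_const_mul _ (by fun_prop)]
  apply lintegral_mono_ae
  filter_upwards [ae0] with y hy
  have := mc3 y
  rw [lintegral_mul_const _ (by fun_prop), ← mul_assoc]
  exact mul_le_mul_left (chi_upper s R hs0 hs1 hR y hy) _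

lemma key (s R : ℝ) (hs0 : 0 < s) (hs1 : s < 1) (hR : 3 ≤ R) (u : E2 → ℂ) (hu : Continuous u) :
    ENNReal.ofReal (R ^ (-2 * s) / 2) * ∫⁻ x : E2, ENNReal.ofReal (‖x‖ ^ (-2 * s)) * ENNReal.ofReal (‖u x‖ ^ 2) ≤
    2 * (∫⁻ h : E2, ENNReal.ofReal (‖h‖ ^ (-2 - 2 * s)) * ∫⁻ x, ENNReal.ofReal (‖u (x + h) - u x‖ ^ 2)) +
    2 * (ENNReal.ofReal (64 * π * R ^ (-2 : ℝ)) * ∫⁻ x : E2, ENNReal.ofReal (‖x‖ ^ (-2 * s)) * ENNReal.ofReal (‖u x‖ ^ 2)) := by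
  have mu : Measurable u := hu.measurable
  rw [key1 s R hs0 hs1 hR u mu]
  refine (key2 s R hs0 hs1 hR u mu).trans ?_
  rw [key3 s R hs0 hs1 hR u mu]
  exact add_le_add (mul_le_mul_right (key4 s R hs0 hs1 hR u mu) 2) (mul_le_mul_right (key5 s R hs0 hs1 hR u mu) 2)

lemma Afin (s : ℝ) (hs0 : 0 < s) (hs1 : s < 1) (u : 𝓢(E2, ℂ)) :
    ∫⁻ x : E2, ENNReal.ofReal (‖x‖ ^ (-2 * s)) * ENNReal.ofReal (‖u x‖ ^ 2) ≠ ⊤ := by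
  have mu : Measurable u := u.continuous.measurable
  have m : Measurable (fun k : E2 => ‖k‖ ^ (-2 * s) * ‖u k‖ ^ 2) := by fun_prop
  have f2 : Module.finrank ℝ E2 = 2 := by simp
  have i1 : IntegrableOn (fun k : E2 => ‖k‖ ^ (-2 * s) * ‖u k‖ ^ 2) (Metric.ball 0 1) := by
    apply integrableOn_ball_of_norm_le_rpow (C := (SchwartzMap.seminorm ℝ 0 0 u) ^ 2) (α := 2 * s) (by simp) (by rw [f2]; norm_num; linarith) _ m.aestronglyMeasurable
    refine .of_forall fun x => ?_
    rw [norm_of_nonneg (by positivity), mul_comm, neg_mul]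
    gcongr
    exact norm_le_seminorm ℝ u x
  have i2 : IntegrableOn (fun k : E2 => ‖k‖ ^ (-2 * s) * ‖u k‖ ^ 2) (Metric.ball 0 1)ᶜ := by
    refine (sq_integrable u).integrableOn.mono' m.aestronglyMeasurable ?_
    refine ae_restrict_of_forall_mem (Metric.isOpen_ball.measurableSet.compl) fun x hx => ?_
    have hx : 1 ≤ ‖x‖ := by simpa using hx
    rw [norm_of_nonneg (by positivity)]
    apply mul_le_of_le_one_left (by positivity)
    exact rpow_le_one_of_one_le_of_nonpos hx (by linarith)
  have i := i1.union i2
  rw [Set.union_compl_self, integrableOn_univ] at i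
  have := i.lintegral_lt_top.ne
  simpa only [ENNReal.ofReal_mul (rpow_nonneg (norm_nonneg _) _)] using this

lemma hardy_gagl (s : ℝ) (hs0 : 0 < s) (hs1 : s < 1) : ∃ q : ℝ, 0 < q ∧ ∀ u : 𝓢(E2, ℂ),
    ENNReal.ofReal q * ∫⁻ x : E2, ENNReal.ofReal (‖x‖ ^ (-2 * s)) * ENNReal.ofReal (‖u x‖ ^ 2) ≤
    2 * (∫⁻ h : E2, ENNReal.ofReal (‖h‖ ^ (-2 - 2 * s)) * ∫⁻ x, ENNReal.ofReal (‖u (x + h) - u x‖ ^ 2)) := by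
  obtain ⟨R, hR, hR3⟩ := (((tendsto_rpow_atTop (show 0 < 2 - 2 * s by linarith)).eventually_ge_atTop (512 * π)).and
    (Filter.eventually_ge_atTop 3)).exists
  have hR0 : 0 < R := by linarith
  refine ⟨R ^ (-2 * s) / 4, by positivity, fun u => ?_⟩
  have k := key s R hs0 hs1 hR3 u u.continuous
  have hA := Afin s hs0 hs1 u
  set A := ∫⁻ x : E2, ENNReal.ofReal (‖x‖ ^ (-2 * s)) * ENNReal.ofReal (‖u x‖ ^ 2)
  set G := ∫⁻ h : E2, ENNReal.ofReal (‖h‖ ^ (-2 - 2 * s)) * ∫⁻ x, ENNReal.ofReal (‖u (x + h) - u x‖ ^ 2)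
  have h1 : 2 * ENNReal.ofReal (64 * π * R ^ (-2 : ℝ)) ≤ ENNReal.ofReal (R ^ (-2 * s) / 4) := by
    rw [show (2 : ENNReal) = ENNReal.ofReal 2 by simp, ← ENNReal.ofReal_mul (by norm_num)]
    apply ENNReal.ofReal_le_ofReal
    have e : R ^ (-2 * s) = R ^ (2 - 2 * s) * R ^ (-2 : ℝ) := by
      rw [← rpow_add hR0]; ring_nf
    rw [e]
    nlinarith [rpow_pos_of_pos hR0 (-2)]
  have h2 : ENNReal.ofReal (R ^ (-2 * s) / 2) = ENNReal.ofReal (R ^ (-2 * s) / 4) + ENNReal.ofReal (R ^ (-2 * s) / 4) := by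
    rw [← ENNReal.ofReal_add (by positivity) (by positivity)]; congr 1; ring
  rw [h2, add_mul, ← mul_assoc 2 _ A] at k
  have k2 := k.trans (add_le_add_right (mul_le_mul_left h1 A) _)
  exact (ENNReal.add_le_add_iff_right (ENNReal.mul_ne_top (by simp) hA)).1 k2

/-- fractional Hardy inequality in dimension 2: for `0 < s < 1` there is `C > 0`
with `‖ |x|^{-s} u ‖_{L²} ≤ C ‖⟨D⟩ˢ u‖_{L²}` for all Schwartz functions `u` on `ℝ²`;
i.e. `|x|^{-s}⟨D⟩^{-s}` extends to a bounded operator on `L²(ℝ²)`. -/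
theorem stmt1 (s : ℝ) (hs0 : 0 < s) (hs1 : s < 1) :
    ∃ C : ℝ, 0 < C ∧ ∀ u : 𝓢(EuclideanSpace ℝ (Fin 2), ℂ),
      eLpNorm (fun x => (‖x‖ ^ (-s) : ℝ) * u x) 2 volume ≤
        ENNReal.ofReal C * eLpNorm (JapD s u) 2 volume := by
  obtain ⟨q, hq, H⟩ := hardy_gagl s hs0 hs1
  have hJ := Jfin s hs0 hs1
  set J := ∫⁻ k : E2, ENNReal.ofReal (min 4 (‖k‖ ^ 2) * ‖k‖ ^ (-2 - 2 * s)) with hJd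
  set D : ℝ := q⁻¹ * (2 * J.toReal) + 1 with hD
  have hD0 : 0 < D := by positivity
  refine ⟨D ^ (1 / 2 : ℝ), by positivity, fun u => ?_⟩
  rw [eLp2, eLp2, ← ENNReal.ofReal_rpow_of_pos hD0, ← ENNReal.mul_rpow_of_nonneg _ _ (by norm_num)]
  apply ENNReal.rpow_le_rpow _ (by norm_num)
  have e : ∀ x : E2, ENNReal.ofReal (‖((‖x‖ ^ (-s) : ℝ) : ℂ) * u x‖ ^ 2) =
      ENNReal.ofReal (‖x‖ ^ (-2 * s)) * ENNReal.ofReal (‖u x‖ ^ 2) := by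
    intro x
    rw [← ENNReal.ofReal_mul (by positivity), norm_mul, mul_pow, Complex.norm_real, norm_of_nonneg (by positivity),
      ← rpow_natCast, ← rpow_mul (norm_nonneg _)]
    congr 3; push_cast; ring
  simp_rw [e]
  rw [japd]
  have h1 := (H u).trans (mul_le_mul_right (gagl s u) 2)
  rw [← hJd] at h1
  set A := ∫⁻ x : E2, ENNReal.ofReal (‖x‖ ^ (-2 * s)) * ENNReal.ofReal (‖u x‖ ^ 2)
  set B := ∫⁻ ξ : E2, ENNReal.ofReal ((1 + 4 * π ^ 2 * ‖ξ‖ ^ 2) ^ s) * ENNReal.ofReal (‖𝓕 u ξ‖ ^ 2)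
  have h2 : A = ENNReal.ofReal q⁻¹ * (ENNReal.ofReal q * A) := by
    rw [← mul_assoc, ← ENNReal.ofReal_mul (by positivity), inv_mul_cancel₀ hq.ne']; simp
  rw [h2]
  refine (mul_le_mul_right h1 _).trans ?_
  rw [← mul_assoc, ← mul_assoc, mul_assoc _ 2 J]
  apply mul_le_mul_left
  rw [hD, ENNReal.ofReal_add (by positivity) (by norm_num), ENNReal.ofReal_mul (by positivity), ENNReal.ofReal_mul (by norm_num),
    ENNReal.ofReal_toReal hJ]
  simp
end
end

section
/- Let H be a self-adjoint operator on a Hilbert space ℋ and A a closed, densely defined operator from ℋ to another Hilbert space. If sup over z ∈ ℂ∖ℝ of the operator norm of A(H−z)^{-1}A* is finite (i.e., A is H-supersmooth), then there exists C > 0 such that for all u₀ ∈ ℋ, the space-time L² norm ∫_ℝ ‖A e^{-itH} u₀‖² dt ≤ C ‖u₀‖². -/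
open MeasureTheory
open scoped ENNReal InnerProductSpace Classical
noncomputable section

namespace KatoAux

open scoped FourierTransform ContDiff SchwartzMap

theorem lintegral_sq {F : Type*} [NormedAddCommGroup F] (k : ℝ → F) :
    ∫⁻ x, ‖k x‖ₑ ^ 2 = eLpNorm k 2 volume ^ 2 := by
  have := eLpNorm_nnreal_pow_eq_lintegral (f := k) (μ := volume) (p := 2) (by norm_num)
  simpa using this.symm

theorem plancherel {F : Type*} [NormedAddCommGroup F] [InnerProductSpace ℂ F] [CompleteSpace F]
    (f : ℝ → F) (h1 : Integrable f) (h2 : MemLp f 2) :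
    ∫⁻ x, ‖𝓕 f x‖ₑ ^ 2 = ∫⁻ x, ‖f x‖ₑ ^ 2 := by
  set G : Lp F 2 (volume : Measure ℝ) := 𝓕 (h2.toLp f) with hG
  have hae : ∀ᵐ x : ℝ, G x = 𝓕 f x := by
    have hcont : Continuous (𝓕 f) :=
      VectorFourier.fourierIntegral_continuous Real.continuous_fourierChar continuous_inner h1
    apply ae_eq_of_integral_contDiff_smul_eq ((Lp.memLp G).locallyIntegrable one_le_two)
      hcont.locallyIntegrable
    intro g g_smooth g_cpt
    have hg₁ : HasCompactSupport (Complex.ofRealCLM ∘ g) := g_cpt.comp_left rfl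
    have hg₂ : ContDiff ℝ ∞ (Complex.ofRealCLM ∘ g) := by fun_prop
    set φ : 𝓢(ℝ, ℂ) := hg₁.toSchwartzMap hg₂ with hφ
    calc ∫ x, g x • G x = Lp.toTemperedDistribution G φ := by simp [φ]
      _ = (𝓕 (Lp.toTemperedDistribution (h2.toLp f))) φ := by
          rw [hG, Lp.fourier_toTemperedDistribution_eq]
      _ = ∫ x, (𝓕 φ) x • (h2.toLp f) x := by
          rw [TemperedDistribution.fourier_apply, Lp.toTemperedDistribution_apply]
      _ = ∫ x, (𝓕 φ) x • f x := by
          apply integral_congr_ae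
          filter_upwards [h2.coeFn_toLp] with x hx
          rw [hx]
      _ = ∫ x, φ x • 𝓕 f x := by
          rw [SchwartzMap.fourier_coe]
          simpa using! VectorFourier.integral_fourierIntegral_smul_eq_flip (μ := volume) (ν := volume) (L := innerₗ ℝ)
            Real.continuous_fourierChar continuous_inner φ.integrable h1
      _ = _ := by simp [φ]
  have hn : ‖G‖ = ‖h2.toLp f‖ := Lp.norm_fourier_eq _
  have hn' : eLpNorm G 2 volume = eLpNorm (h2.toLp f) 2 volume := by
    rw [Lp.norm_def, Lp.norm_def] at hn
    exact (ENNReal.toReal_eq_toReal_iff' (Lp.eLpNorm_ne_top _) (Lp.eLpNorm_ne_top _)).1 hn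
  rw [eLpNorm_congr_ae hae, eLpNorm_congr_ae h2.coeFn_toLp] at hn'
  rw [lintegral_sq, lintegral_sq, hn']

theorem mem_domain_of_bound {ℋ 𝒦 : Type*}
    [NormedAddCommGroup ℋ] [InnerProductSpace ℂ ℋ] [CompleteSpace ℋ]
    [NormedAddCommGroup 𝒦] [InnerProductSpace ℂ 𝒦] [CompleteSpace 𝒦]
    (A : ℋ →ₗ.[ℂ] 𝒦) (hAdense : Dense (A.domain : Set ℋ)) (hAclosed : A.IsClosed)
    (v : ℋ) (c : ℝ) (hc : 0 ≤ c)
    (hb : ∀ f : A.adjoint.domain, ‖(⟪v, A.adjoint f⟫_ℂ : ℂ)‖ ≤ c * ‖(f : 𝒦)‖) :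
    ∃ h : v ∈ A.domain, ‖A ⟨v, h⟩‖ ≤ c := by
  set L0 : A.adjoint.domain →ₗ[ℂ] ℂ := (innerₛₗ ℂ v).comp A.adjoint.toFun with hL0
  set L : StrongDual ℂ A.adjoint.domain := L0.mkContinuous c (fun f => by simpa [L0] using hb f)
  obtain ⟨g, hg, hgn⟩ := exists_extension_norm_eq A.adjoint.domain L
  set w : 𝒦 := (InnerProductSpace.toDual ℂ 𝒦).symm g with hw
  have hwn : ‖w‖ ≤ c := by
    rw [hw, LinearIsometryEquiv.norm_map, hgn]
    exact L0.mkContinuous_norm_le hc _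
  have hwin : ∀ f : A.adjoint.domain, (⟪w, (f : 𝒦)⟫_ℂ : ℂ) = ⟪v, A.adjoint f⟫_ℂ := by
    intro f
    rw [hw, InnerProductSpace.toDual_symm_apply, hg]
    rfl
  have hmem : (v, w) ∈ A.graph := by
    let K : Submodule ℂ (WithLp 2 (ℋ × 𝒦)) :=
      A.graph.comap (WithLp.linearEquiv 2 ℂ (ℋ × 𝒦)).toLinearMap
    have hK : IsClosed (K : Set (WithLp 2 (ℋ × 𝒦))) :=
      IsClosed.preimage (WithLp.prod_continuous_ofLp 2 ℋ 𝒦) hAclosed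
    have : WithLp.toLp 2 (v, w) ∈ K := by
      have : CompleteSpace K := hK.completeSpace_coe
      rw [← Submodule.orthogonal_orthogonal K, Submodule.mem_orthogonal]
      intro p hp
      rw [Submodule.mem_orthogonal] at hp
      have hp' : ∀ x : A.domain, (⟪(-p.fst : ℋ), (x : ℋ)⟫_ℂ : ℂ) = ⟪p.snd, A x⟫_ℂ := by
        intro x
        have := hp (WithLp.toLp 2 ((x : ℋ), A x)) (by
          change ((x : ℋ), A x) ∈ A.graph
          exact A.mem_graph x)
        rw [WithLp.prod_inner_apply] at this
        simp only [] at this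
        have h2 := congrArg (starRingEnd ℂ) this
        rw [map_add, inner_conj_symm, inner_conj_symm, map_zero] at h2
        rw [inner_neg_left]
        exact (eq_neg_of_add_eq_zero_right h2).symm
      have hd : p.snd ∈ A.adjoint.domain := A.mem_adjoint_domain_of_exists _ ⟨_, hp'⟩
      have he : A.adjoint ⟨p.snd, hd⟩ = -p.fst := LinearPMap.adjoint_apply_eq hAdense _ hp'
      have h3 := hwin ⟨p.snd, hd⟩
      rw [he] at h3
      have h2 := congrArg (starRingEnd ℂ) h3
      rw [inner_conj_symm, inner_conj_symm, inner_neg_left] at h2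
      rw [WithLp.prod_inner_apply]
      simp only [] at h2 ⊢
      change (⟪p.fst, v⟫_ℂ : ℂ) + ⟪p.snd, w⟫_ℂ = 0
      rw [h2]; ring
    exact this
  obtain ⟨y, hy1, hy2⟩ := (LinearPMap.mem_graph_iff A).1 hmem
  simp only at hy1 hy2
  subst hy1
  exact ⟨y.2, by rw [hy2]; exact hwn⟩


structure Setup {ℋ : Type*} [NormedAddCommGroup ℋ] [InnerProductSpace ℂ ℋ]
    (H : ℋ →ₗ.[ℂ] ℋ) (R : ℂ → ℋ →L[ℂ] ℋ) (U : ℝ → ℋ →L[ℂ] ℋ) : Prop where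
  sym : ∀ x y : H.domain, (⟪H x, (y : ℋ)⟫_ℂ : ℂ) = ⟪(x : ℋ), H y⟫_ℂ
  dense : Dense (H.domain : Set ℋ)
  mem : ∀ z : ℂ, z.im ≠ 0 → ∀ u : ℋ, R z u ∈ H.domain
  eq : ∀ (z : ℂ) (hz : z.im ≠ 0) (u : ℋ), H ⟨R z u, mem z hz u⟩ - z • R z u = u
  inv : ∀ (z : ℂ), z.im ≠ 0 → ∀ u : H.domain, R z (H u - z • (u : ℋ)) = u
  U0 : U 0 = ContinuousLinearMap.id ℂ ℋ
  Uadd : ∀ s t : ℝ, U (s + t) = (U s).comp (U t)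
  iso : ∀ (t : ℝ) (u : ℋ), ‖U t u‖ = ‖u‖
  gen : ∀ u : H.domain, ∀ t : ℝ,
      HasDerivAt (fun τ : ℝ => U τ (u : ℋ)) (-(Complex.I • U t (H u))) t

namespace Setup

set_option linter.unusedSectionVars false

open Set Filter Topology

variable {ℋ : Type*} [NormedAddCommGroup ℋ] [InnerProductSpace ℂ ℋ] [CompleteSpace ℋ]
    {H : ℋ →ₗ.[ℂ] ℋ} {R : ℂ → ℋ →L[ℂ] ℋ} {U : ℝ → ℋ →L[ℂ] ℋ}

theorem cont (S : Setup H R U) (u : ℋ) : Continuous (fun t => U t u) := by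
  apply continuous_of_uniform_approx_of_continuous
  rw [Metric.uniformity_basis_dist_le.forall_iff (by
    intro s t hst h; obtain ⟨F, hF, h⟩ := h; exact ⟨F, hF, fun y => hst (h y)⟩)]
  intro ε hε
  obtain ⟨x, hx, hd⟩ := Metric.dense_iff.1 S.dense u ε hε
  refine ⟨fun t => U t x, ?_, fun y => ?_⟩
  · exact continuous_iff_continuousAt.2 fun t => (S.gen ⟨x, hd⟩ t).continuousAt
  · simp only [Set.mem_ofPred_eq, dist_eq_norm]
    rw [← map_sub, S.iso, ← dist_eq_norm, dist_comm]
    exact (Metric.mem_ball.1 hx).le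

theorem norm_exp (z : ℂ) (t : ℝ) :
    ‖Complex.exp (Complex.I * z * (t : ℂ))‖ = Real.exp (-z.im * t) := by
  rw [Complex.norm_exp]; simp

theorem contE (S : Setup H R U) (z : ℂ) (u : ℋ) :
    Continuous (fun t : ℝ => Complex.exp (Complex.I * z * (t : ℂ)) • U t u) := by
  have := S.cont u
  fun_prop

theorem normE (S : Setup H R U) (z : ℂ) (u : ℋ) (t : ℝ) :
    ‖Complex.exp (Complex.I * z * (t : ℂ)) • U t u‖ = Real.exp (-z.im * t) * ‖u‖ := by
  rw [norm_smul, norm_exp, S.iso]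

theorem int_pos (S : Setup H R U) {z : ℂ} (hz : 0 < z.im) (u : ℋ) :
    IntegrableOn (fun t : ℝ => Complex.exp (Complex.I * z * (t : ℂ)) • U t u) (Ioi 0) := by
  have h := (integrableOn_exp_mul_Ioi (a := -z.im) (by linarith) 0).mul_const ‖u‖
  refine Integrable.mono' h (S.contE z u).aestronglyMeasurable ?_
  exact Eventually.of_forall fun t => (S.normE z u t).le

theorem int_neg (S : Setup H R U) {z : ℂ} (hz : z.im < 0) (u : ℋ) :
    IntegrableOn (fun t : ℝ => Complex.exp (Complex.I * z * (t : ℂ)) • U t u) (Iic 0) := by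
  have h := (integrableOn_exp_mul_Iic (a := -z.im) (by linarith) 0).mul_const ‖u‖
  refine Integrable.mono' h (S.contE z u).aestronglyMeasurable ?_
  exact Eventually.of_forall fun t => (S.normE z u t).le

theorem derivE (S : Setup H R U) {z : ℂ} (hz : z.im ≠ 0) (u : ℋ) (t : ℝ) :
    HasDerivAt (fun t : ℝ => Complex.exp (Complex.I * z * (t : ℂ)) • U t (R z u))
      (-(Complex.I • Complex.exp (Complex.I * z * (t : ℂ)) • U t u)) t := by
  have h1 := S.gen ⟨R z u, S.mem z hz u⟩ t
  have h2 : HasDerivAt (fun t : ℝ => Complex.exp (Complex.I * z * (t : ℂ)))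
      (Complex.exp (Complex.I * z * (t : ℂ)) * (Complex.I * z)) t := by
    have h3 : HasDerivAt (fun t : ℝ => Complex.I * z * (t : ℂ)) (Complex.I * z * 1) t :=
      (Complex.ofRealCLM.hasDerivAt (x := t)).const_mul _
    rw [mul_one] at h3
    exact h3.cexp
  have h4 := h2.smul h1
  refine HasDerivAt.congr_deriv h4 ?_
  have h5 : U t u = U t (H ⟨R z u, S.mem z hz u⟩) - z • U t (R z u) := by
    rw [← map_smul, ← map_sub, S.eq z hz u]
  rw [h5]
  module

theorem lap_pos (S : Setup H R U) {z : ℂ} (hz : 0 < z.im) (u : ℋ) :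
    R z u = Complex.I • ∫ t in Ioi (0 : ℝ), Complex.exp (Complex.I * z * (t : ℂ)) • U t u := by
  have key := integral_Ioi_of_hasDerivAt_of_tendsto' (a := 0) (m := (0 : ℋ))
    (fun t _ => S.derivE hz.ne' u t) ((S.int_pos hz u).smul Complex.I).neg ?_
  · rw [integral_neg, integral_smul] at key
    simpa [S.U0] using key.symm
  · rw [tendsto_zero_iff_norm_tendsto_zero]
    simp_rw [S.normE]
    rw [← zero_mul ‖R z u‖]
    refine Tendsto.mul_const _ (Real.tendsto_exp_atBot.comp ?_)
    exact tendsto_id.const_mul_atTop_of_neg (by linarith)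

theorem lap_neg (S : Setup H R U) {z : ℂ} (hz : z.im < 0) (u : ℋ) :
    R z u = -(Complex.I • ∫ t in Iic (0 : ℝ), Complex.exp (Complex.I * z * (t : ℂ)) • U t u) := by
  have key := integral_Iic_of_hasDerivAt_of_tendsto' (a := 0) (m := (0 : ℋ))
    (fun t _ => S.derivE hz.ne u t) ((S.int_neg hz u).smul Complex.I).neg ?_
  · rw [integral_neg, integral_smul] at key
    simpa [S.U0] using key.symm
  · rw [tendsto_zero_iff_norm_tendsto_zero]
    simp_rw [S.normE]
    rw [← zero_mul ‖R z u‖]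
    refine Tendsto.mul_const _ (Real.tendsto_exp_atBot.comp ?_)
    exact tendsto_id.const_mul_atBot (by linarith)

theorem comm_of_comm (S : Setup H R U) {z : ℂ} (hz : z.im ≠ 0) (T : ℋ →L[ℂ] ℋ)
    (hT : ∀ t u, T (U t u) = U t (T u)) (u : ℋ) : T (R z u) = R z (T u) := by
  rcases lt_or_gt_of_ne hz with h | h
  · rw [S.lap_neg h, S.lap_neg h, map_neg, map_smul, ← T.integral_comp_comm (S.int_neg h u)]
    simp_rw [map_smul, hT]
  · rw [S.lap_pos h, S.lap_pos h, map_smul, ← T.integral_comp_comm (S.int_pos h u)]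
    simp_rw [map_smul, hT]

theorem commU (S : Setup H R U) {z : ℂ} (hz : z.im ≠ 0) (t : ℝ) (u : ℋ) :
    U t (R z u) = R z (U t u) := by
  apply S.comm_of_comm hz
  intro s u
  have h1 := S.Uadd s t
  rw [add_comm, S.Uadd t s] at h1
  exact congrArg (fun T => T u) h1

theorem commR (S : Setup H R U) {z w : ℂ} (hz : z.im ≠ 0) (hw : w.im ≠ 0) (u : ℋ) :
    R w (R z u) = R z (R w u) :=
  S.comm_of_comm hz _ (fun t u => (S.commU hw t u).symm) u

theorem res_id (S : Setup H R U) {z w : ℂ} (hz : z.im ≠ 0) (hw : w.im ≠ 0) (u : ℋ) :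
    R z u = R w u + (z - w) • R z (R w u) := by
  have h1 := S.eq w hw u
  have h2 := S.inv z hz ⟨R w u, S.mem w hw u⟩
  have h3 : u = (H ⟨R w u, S.mem w hw u⟩ - z • R w u) + (z - w) • R w u := by
    rw [← sub_eq_zero]
    nth_rewrite 1 [← h1]
    module
  conv_lhs => rw [h3]
  rw [map_add, map_smul, h2]

theorem adjR (S : Setup H R U) {z : ℂ} (hz : z.im ≠ 0) (u v : ℋ) :
    (⟪R z u, v⟫_ℂ : ℂ) = ⟪u, R (starRingEnd ℂ z) v⟫_ℂ := by
  have hz' : (starRingEnd ℂ z).im ≠ 0 := by simpa using hz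
  conv_lhs => rw [← S.eq _ hz' v]
  conv_rhs => rw [← S.eq _ hz u]
  rw [inner_sub_right, inner_sub_left, inner_smul_right, inner_smul_left]
  rw [S.sym ⟨R z u, _⟩ ⟨R _ v, S.mem _ hz' v⟩]

theorem im_inner (S : Setup H R U) {z : ℂ} (hz : z.im ≠ 0) (a : ℋ) :
    |z.im| * ‖R z a‖ ^ 2 ≤ ‖(⟪R z a, a⟫_ℂ : ℂ)‖ := by
  have h0 : (⟪R z a, a⟫_ℂ : ℂ) = ⟪R z a, H ⟨R z a, S.mem z hz a⟩⟫_ℂ - z * (‖R z a‖ : ℂ) ^ 2 := by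
    have h00 : (⟪R z a, a⟫_ℂ : ℂ) = ⟪R z a, H ⟨R z a, S.mem z hz a⟩ - z • R z a⟫_ℂ := by
      rw [S.eq z hz a]
    rw [h00, inner_sub_right, inner_smul_right, inner_self_eq_norm_sq_to_K]
    rfl
  have h1 : (⟪R z a, H ⟨R z a, S.mem z hz a⟩⟫_ℂ : ℂ).im = 0 := by
    apply Complex.conj_eq_iff_im.1
    rw [inner_conj_symm]
    exact S.sym ⟨R z a, S.mem z hz a⟩ ⟨R z a, S.mem z hz a⟩
  have h2 : (⟪R z a, a⟫_ℂ : ℂ).im = -(z.im * ‖R z a‖ ^ 2) := by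
    rw [h0, Complex.sub_im, h1, ← Complex.ofReal_pow, Complex.im_mul_ofReal]; ring
  calc _ = |(⟪R z a, a⟫_ℂ : ℂ).im| := by rw [h2, abs_neg, abs_mul, abs_of_nonneg (sq_nonneg ‖R z a‖)]
    _ ≤ _ := Complex.abs_im_le_norm _


theorem domA {𝒦 : Type*} [NormedAddCommGroup 𝒦] [InnerProductSpace ℂ 𝒦] [CompleteSpace 𝒦]
    (S : Setup H R U)
    (A : ℋ →ₗ.[ℂ] 𝒦) (hAdense : Dense (A.domain : Set ℋ)) (hAclosed : A.IsClosed)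
    (M : ℝ) (hM : 0 ≤ M)
    (hsmooth : ∀ z : ℂ, z.im ≠ 0 → ∀ f g : A.adjoint.domain,
      ‖(⟪R z (A.adjoint f), (A.adjoint g : ℋ)⟫_ℂ : ℂ)‖ ≤ M * ‖(f : 𝒦)‖ * ‖(g : 𝒦)‖)
    {z : ℂ} (hz : z.im ≠ 0) (u : ℋ) :
    ∃ h : R z u ∈ A.domain, ‖A ⟨R z u, h⟩‖ ≤ √(M / |z.im|) * ‖u‖ := by
  apply mem_domain_of_bound A hAdense hAclosed _ _ (by positivity)
  intro f
  have hz' : (starRingEnd ℂ z).im ≠ 0 := by simpa using hz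
  have hpos : 0 < |z.im| := abs_pos.2 hz
  have h1 := (S.im_inner hz' (A.adjoint f)).trans (hsmooth _ hz' f f)
  have h2 : ‖R (starRingEnd ℂ z) (A.adjoint f)‖ ≤ √(M / |z.im|) * ‖(f : 𝒦)‖ := by
    apply le_of_sq_le_sq _ (by positivity)
    rw [mul_pow, Real.sq_sqrt (by positivity), div_mul_eq_mul_div, le_div_iff₀ hpos]
    simp only [Complex.conj_im, abs_neg] at h1
    nlinarith [h1]
  rw [S.adjR hz]
  calc _ ≤ ‖u‖ * ‖R (starRingEnd ℂ z) (A.adjoint f)‖ := norm_inner_le_norm _ _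
    _ ≤ ‖u‖ * (√(M / |z.im|) * ‖(f : 𝒦)‖) := by gcongr
    _ = _ := by ring

/-- the spectral parameter belonging to the frequency `ξ` -/
def par (ε ξ : ℝ) : ℂ := ((-(2 * Real.pi * ξ) : ℝ) : ℂ) + (ε : ℂ) * Complex.I

theorem par_im (ε ξ : ℝ) : (par ε ξ).im = ε := by simp [par]

theorem par_exp (ε ξ t : ℝ) :
    Complex.exp (((-2 * Real.pi * t * ξ : ℝ) : ℂ) * Complex.I) * (Real.exp (-ε * t) : ℂ)
      = Complex.exp (Complex.I * par ε ξ * t) := by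
  rw [Complex.ofReal_exp, ← Complex.exp_add]
  congr 1
  simp only [par]
  push_cast
  linear_combination (-(ε : ℂ) * t) * Complex.I_sq

theorem half_l2 (S : Setup H R U) {ε : ℝ} (hε : 0 < ε) (u : ℋ) :
    ∫⁻ ξ, ‖R (par (-ε) ξ) u‖ₑ ^ 2 = ENNReal.ofReal (‖u‖ ^ 2 / (2 * ε)) := by
  set k : ℝ → ℋ := fun t => (Real.exp (-(-ε) * t) : ℂ) • U t u with hk
  set h : ℝ → ℋ := indicator (Iic 0) k with hh
  have hkc : Continuous k := by
    have := S.cont u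
    fun_prop
  have hkn : ∀ t, ‖k t‖ = Real.exp (ε * t) * ‖u‖ := by
    intro t
    simp only [hk]
    rw [norm_smul, S.iso, Complex.norm_real, Real.norm_of_nonneg (Real.exp_nonneg _), neg_neg]
  have hi : IntegrableOn k (Iic 0) := by
    have h := (integrableOn_exp_mul_Iic (a := ε) hε 0).mul_const ‖u‖
    exact Integrable.mono' h hkc.aestronglyMeasurable (Eventually.of_forall fun t => (hkn t).le)
  have hi2 : IntegrableOn (fun t => ‖k t‖ ^ 2) (Iic 0) := by
    have h := (integrableOn_exp_mul_Iic (a := 2 * ε) (by linarith) 0).mul_const (‖u‖ ^ 2)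
    refine h.congr (Eventually.of_forall fun t => ?_)
    simp only [hkn]
    rw [mul_pow, ← Real.exp_nat_mul]
    congr 2
    push_cast; ring
  have hF : ∀ ξ, R (par (-ε) ξ) u = -(Complex.I • 𝓕 h ξ) := by
    intro ξ
    rw [S.lap_neg (by rw [par_im]; linarith), Real.fourier_real_eq_integral_exp_smul,
      ← integral_indicator measurableSet_Iic]
    congr 3
    ext t
    by_cases ht : t ∈ Iic (0 : ℝ)
    · simp only [hh, indicator_of_mem ht, hk]
      rw [smul_smul, par_exp]
    · simp only [hh, indicator_of_notMem ht, smul_zero]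
  have h1 : Integrable h := hi.integrable_indicator measurableSet_Iic
  have h2 : MemLp h 2 := by
    rw [hh, memLp_indicator_iff_restrict measurableSet_Iic]
    exact (memLp_two_iff_integrable_sq_norm hkc.aestronglyMeasurable).2 hi2
  have h3 : ∀ ξ, ‖R (par (-ε) ξ) u‖ₑ ^ 2 = ‖𝓕 h ξ‖ₑ ^ 2 := by
    intro ξ
    rw [hF, enorm_neg, enorm_smul]
    simp [enorm_eq_nnnorm]
  simp_rw [h3]
  rw [plancherel h h1 h2]
  have h4 : ∀ t, ‖h t‖ₑ ^ 2 = indicator (Iic 0) (fun t => ENNReal.ofReal (‖k t‖ ^ 2)) t := by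
    intro t
    by_cases ht : t ∈ Iic (0 : ℝ)
    · simp only [hh, indicator_of_mem ht]
      rw [ENNReal.ofReal_pow (norm_nonneg _), ofReal_norm]
    · simp only [hh, indicator_of_notMem ht]
      simp
  simp_rw [h4]
  rw [lintegral_indicator measurableSet_Iic, ← ofReal_integral_eq_lintegral_ofReal hi2
    (Eventually.of_forall fun t => sq_nonneg _)]
  congr 1
  have h5 : ∀ t, ‖k t‖ ^ 2 = Real.exp (2 * ε * t) * ‖u‖ ^ 2 := by
    intro t
    rw [hkn, mul_pow, ← Real.exp_nat_mul]
    congr 2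
    push_cast; ring
  simp_rw [h5]
  rw [integral_mul_const, integral_exp_mul_Iic (by linarith)]
  simp
  ring

theorem main_est {𝒦 : Type*} [NormedAddCommGroup 𝒦] [InnerProductSpace ℂ 𝒦] [CompleteSpace 𝒦]
    (S : Setup H R U) (B : ℋ →L[ℂ] 𝒦) (M : ℝ) (hM : 0 ≤ M)
    (hB : ∀ z : ℂ, z.im ≠ 0 → ∀ x, ‖B (R z x)‖ ^ 2 ≤ M / |z.im| * ‖R Complex.I x‖ ^ 2)
    (v : ℋ) {ε : ℝ} (hε : 0 < ε) :
    ∫⁻ t : ℝ, ‖(Real.exp (-ε * |t|) : ℂ) • B (U t v)‖ₑ ^ 2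
      ≤ ENNReal.ofReal (2 * M * ‖R Complex.I v‖ ^ 2) := by
  set G : ℝ → ℋ := fun t => (Real.exp (-ε * |t|) : ℂ) • U t v with hG
  set g : ℝ → 𝒦 := fun t => (Real.exp (-ε * |t|) : ℂ) • B (U t v) with hg
  have hgG : ∀ t, g t = B (G t) := fun t => by simp only [hg, hG, map_smul]
  have hGc : Continuous G := by
    have := S.cont v
    fun_prop
  have hgc : Continuous g := by
    have := S.cont v
    fun_prop
  have hGn : ∀ t, ‖G t‖ = Real.exp (-ε * |t|) * ‖v‖ := by
    intro t
    simp only [hG]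
    rw [norm_smul, S.iso, Complex.norm_real, Real.norm_of_nonneg (Real.exp_nonneg _)]
  have hexp : ∀ a : ℝ, 0 < a → Integrable (fun t : ℝ => Real.exp (-a * |t|)) := by
    intro a ha
    rw [← integrableOn_univ, ← Iic_union_Ioi (a := (0 : ℝ)), integrableOn_union]
    constructor
    · refine (integrableOn_exp_mul_Iic (a := a) ha 0).congr_fun (fun t ht => ?_) measurableSet_Iic
      simp only
      rw [abs_of_nonpos ht]; congr 1; ring
    · refine (integrableOn_exp_mul_Ioi (a := -a) (by linarith) 0).congr_fun (fun t ht => ?_)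
        measurableSet_Ioi
      simp only
      rw [abs_of_pos ht]
  have hGi : Integrable G :=
    Integrable.mono' ((hexp ε hε).mul_const ‖v‖) hGc.aestronglyMeasurable
      (Eventually.of_forall fun t => (hGn t).le)
  have hgi : Integrable g := by
    have := B.integrable_comp hGi
    exact this.congr (Eventually.of_forall fun t => (hgG t).symm)
  have hg2 : MemLp g 2 := by
    refine (memLp_two_iff_integrable_sq_norm hgc.aestronglyMeasurable).2 ?_
    refine Integrable.mono' ((hexp (2 * ε) (by linarith)).mul_const ((‖B‖ * ‖v‖) ^ 2))
      (hgc.norm.pow 2).aestronglyMeasurable (Eventually.of_forall fun t => ?_)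
    rw [Real.norm_of_nonneg (sq_nonneg _)]
    have h1 : ‖g t‖ ≤ ‖B‖ * (Real.exp (-ε * |t|) * ‖v‖) := by
      rw [hgG, ← hGn]; exact B.le_opNorm _
    calc ‖g t‖ ^ 2 ≤ (‖B‖ * (Real.exp (-ε * |t|) * ‖v‖)) ^ 2 := by gcongr
      _ = (Real.exp (-ε * |t|)) ^ 2 * (‖B‖ * ‖v‖) ^ 2 := by ring
      _ = _ := by
        rw [← Real.exp_nat_mul]
        congr 2
        push_cast; ring
  rw [← plancherel g hgi hg2]
  have hF : ∀ ξ, 𝓕 g ξ = (2 * ε : ℂ) • B (R (par ε ξ) (R (par (-ε) ξ) v)) := by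
    intro ξ
    have hp1 : (par ε ξ).im ≠ 0 := by rw [par_im]; exact hε.ne'
    have hp2 : (par (-ε) ξ).im ≠ 0 := by rw [par_im]; exact (neg_neg_of_pos hε).ne
    have hp1' : 0 < (par ε ξ).im := by rw [par_im]; exact hε
    have hp2' : (par (-ε) ξ).im < 0 := by rw [par_im]; linarith
    have e1 : ∀ t ∈ Iic (0 : ℝ), Complex.exp (((-2 * Real.pi * t * ξ : ℝ) : ℂ) * Complex.I) • G t
        = Complex.exp (Complex.I * par (-ε) ξ * t) • U t v := by
      intro t ht
      simp only [hG]
      rw [smul_smul, ← par_exp, abs_of_nonpos ht]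
      congr 4; ring
    have e2 : ∀ t ∈ Ioi (0 : ℝ), Complex.exp (((-2 * Real.pi * t * ξ : ℝ) : ℂ) * Complex.I) • G t
        = Complex.exp (Complex.I * par ε ξ * t) • U t v := by
      intro t ht
      simp only [hG]
      rw [smul_smul, ← par_exp, abs_of_pos ht]
    have hEc : Continuous fun t : ℝ => Complex.exp (((-2 * Real.pi * t * ξ : ℝ) : ℂ) * Complex.I) • G t := by
      fun_prop
    have i1 := (S.int_neg hp2' v).congr_fun (fun t ht => (e1 t ht).symm) measurableSet_Iic
    have i2 := (S.int_pos hp1' v).congr_fun (fun t ht => (e2 t ht).symm) measurableSet_Ioi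
    have i3 : Integrable fun t : ℝ =>
        Complex.exp (((-2 * Real.pi * t * ξ : ℝ) : ℂ) * Complex.I) • G t := by
      rw [← integrableOn_univ, ← Iic_union_Ioi (a := (0 : ℝ)), integrableOn_union]
      exact ⟨i1, i2⟩
    rw [Real.fourier_real_eq_integral_exp_smul]
    simp_rw [hgG, ← map_smul B]
    rw [B.integral_comp_comm i3]
    congr 1
    rw [← setIntegral_univ, ← Iic_union_Ioi (a := (0 : ℝ)),
      setIntegral_union (Iic_disjoint_Ioi le_rfl) measurableSet_Ioi i1 i2,
      setIntegral_congr_fun measurableSet_Iic e1, setIntegral_congr_fun measurableSet_Ioi e2]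
    have r1 := S.lap_neg hp2' v
    have r2 := S.lap_pos hp1' v
    have r3 := S.res_id hp1 hp2 v
    set X := ∫ t in Iic (0 : ℝ), Complex.exp (Complex.I * par (-ε) ξ * t) • U t v
    set Y := ∫ t in Ioi (0 : ℝ), Complex.exp (Complex.I * par ε ξ * t) • U t v
    have r4 : par ε ξ - par (-ε) ξ = 2 * ε * Complex.I := by
      simp only [par]; push_cast; ring
    rw [r4] at r3
    have r5 : X + Y = (-Complex.I) • (R (par ε ξ) v - R (par (-ε) ξ) v) := by
      rw [r1, r2, sub_neg_eq_add, ← smul_add, smul_smul]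
      simp [add_comm]
    rw [r5]
    nth_rewrite 1 [r3]
    rw [add_sub_cancel_left, smul_smul]
    congr 1
    linear_combination (-2 * (ε : ℂ)) * Complex.I_sq
  have hle : ∀ ξ, ‖𝓕 g ξ‖ₑ ^ 2 ≤
      ENNReal.ofReal (4 * ε * M) * ‖R (par (-ε) ξ) (R Complex.I v)‖ₑ ^ 2 := by
    intro ξ
    have hp1 : (par ε ξ).im ≠ 0 := by rw [par_im]; exact hε.ne'
    have hp2 : (par (-ε) ξ).im ≠ 0 := by rw [par_im]; exact (neg_neg_of_pos hε).ne
    have h1 := hB (par ε ξ) hp1 (R (par (-ε) ξ) v)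
    rw [S.commR (w := Complex.I) hp2 (by simp) v, par_im, abs_of_pos hε] at h1
    rw [← ofReal_norm, ← ofReal_norm, ← ENNReal.ofReal_pow (norm_nonneg _),
      ← ENNReal.ofReal_pow (norm_nonneg _), ← ENNReal.ofReal_mul (by positivity)]
    apply ENNReal.ofReal_le_ofReal
    rw [hF, norm_smul, mul_pow]
    have h2 : ‖(2 * ε : ℂ)‖ = 2 * ε := by
      simp [abs_of_pos hε]
    rw [h2]
    calc _ ≤ (2 * ε) ^ 2 * (M / ε * ‖R (par (-ε) ξ) (R Complex.I v)‖ ^ 2) := by gcongr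
      _ = _ := by field_simp; ring
  calc _ ≤ ∫⁻ ξ, ENNReal.ofReal (4 * ε * M) * ‖R (par (-ε) ξ) (R Complex.I v)‖ₑ ^ 2 :=
        lintegral_mono hle
    _ = ENNReal.ofReal (4 * ε * M) * ∫⁻ ξ, ‖R (par (-ε) ξ) (R Complex.I v)‖ₑ ^ 2 :=
        lintegral_const_mul' _ _ ENNReal.ofReal_ne_top
    _ = _ := by
      rw [S.half_l2 hε, ← ENNReal.ofReal_mul (by positivity)]
      congr 1
      field_simp; ring


theorem full_est {𝒦 : Type*} [NormedAddCommGroup 𝒦] [InnerProductSpace ℂ 𝒦] [CompleteSpace 𝒦]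
    (S : Setup H R U) (B : ℋ →L[ℂ] 𝒦) (M : ℝ) (hM : 0 ≤ M)
    (hB : ∀ z : ℂ, z.im ≠ 0 → ∀ x, ‖B (R z x)‖ ^ 2 ≤ M / |z.im| * ‖R Complex.I x‖ ^ 2)
    (v : ℋ) :
    ∫⁻ t : ℝ, ‖B (U t v)‖ₑ ^ 2 ≤ ENNReal.ofReal (2 * M * ‖R Complex.I v‖ ^ 2) := by
  set f : ℕ → ℝ → ℝ≥0∞ := fun n t =>
    ‖(Real.exp (-(1 / ((n : ℝ) + 1)) * |t|) : ℂ) • B (U t v)‖ₑ ^ 2 with hf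
  have hlim : ∀ t, Tendsto (fun n => f n t) atTop (𝓝 (‖B (U t v)‖ₑ ^ 2)) := by
    intro t
    have hc : Continuous fun s : ℝ => ‖(Real.exp (-s * |t|) : ℂ) • B (U t v)‖ₑ ^ 2 := by
      refine (ENNReal.continuous_pow 2).comp (continuous_enorm.comp ?_)
      fun_prop
    have h1 := (hc.tendsto 0).comp tendsto_one_div_add_atTop_nhds_zero_nat
    simpa [hf, Function.comp_def] using h1
  have hmeas : ∀ n, Measurable (f n) := by
    intro n
    have := S.cont v
    have hc : Continuous (f n) := by
      refine (ENNReal.continuous_pow 2).comp (continuous_enorm.comp ?_)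
      fun_prop
    exact hc.measurable
  calc ∫⁻ t : ℝ, ‖B (U t v)‖ₑ ^ 2 = ∫⁻ t, liminf (fun n => f n t) atTop :=
        lintegral_congr fun t => (hlim t).liminf_eq.symm
    _ ≤ liminf (fun n => ∫⁻ t, f n t) atTop := lintegral_liminf_le hmeas
    _ ≤ liminf (fun _ : ℕ => ENNReal.ofReal (2 * M * ‖R Complex.I v‖ ^ 2)) atTop := by
        refine liminf_le_liminf (Eventually.of_forall fun n => ?_)
        exact S.main_est B M hM hB v (by positivity)
    _ = _ := liminf_const _

theorem final {𝒦 : Type*} [NormedAddCommGroup 𝒦] [InnerProductSpace ℂ 𝒦] [CompleteSpace 𝒦]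
    (S : Setup H R U)
    (A : ℋ →ₗ.[ℂ] 𝒦) (hAdense : Dense (A.domain : Set ℋ)) (hAclosed : A.IsClosed)
    (M : ℝ) (hM : 0 ≤ M)
    (hsmooth : ∀ z : ℂ, z.im ≠ 0 → ∀ f g : A.adjoint.domain,
      ‖(⟪R z (A.adjoint f), (A.adjoint g : ℋ)⟫_ℂ : ℂ)‖ ≤ M * ‖(f : 𝒦)‖ * ‖(g : 𝒦)‖)
    (u₀ : ℋ) :
    ∃ F : Lp 𝒦 2 (volume : Measure ℝ), ‖F‖ ≤ √(2 * M) * ‖u₀‖ ∧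
      ∀ᵐ t : ℝ, (U t u₀, F t) ∈ A.graph := by
  have hI : Complex.I.im ≠ 0 := by simp
  have dom := fun {z : ℂ} (hz : z.im ≠ 0) (u : ℋ) => S.domA A hAdense hAclosed M hM hsmooth hz u
  let B0 : ℋ →ₗ[ℂ] 𝒦 :=
    A.toFun.comp ((R Complex.I : ℋ →ₗ[ℂ] ℋ).codRestrict A.domain (fun u => (dom hI u).1))
  let B : ℋ →L[ℂ] 𝒦 := B0.mkContinuous (√(M / |Complex.I.im|)) (fun u => (dom hI u).2)
  have hBv : ∀ v, B v = A ⟨R Complex.I v, (dom hI v).1⟩ := fun v => rfl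
  have hB : ∀ z : ℂ, z.im ≠ 0 → ∀ x, ‖B (R z x)‖ ^ 2 ≤ M / |z.im| * ‖R Complex.I x‖ ^ 2 := by
    intro z hz x
    obtain ⟨h, hle⟩ := dom hz (R Complex.I x)
    have e : B (R z x) = A ⟨R z (R Complex.I x), h⟩ := by
      rw [hBv]
      congr 2
      exact S.commR hz hI x
    rw [e]
    calc _ ≤ (√(M / |z.im|) * ‖R Complex.I x‖) ^ 2 := by gcongr
      _ = _ := by rw [mul_pow, Real.sq_sqrt (by positivity)]
  have hest : ∀ v, eLpNorm (fun t => B (U t v)) 2 volume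
      ≤ ENNReal.ofReal (√(2 * M) * ‖R Complex.I v‖) := by
    intro v
    have h1 := S.full_est B M hM hB v
    rw [lintegral_sq] at h1
    have h2 : ENNReal.ofReal (2 * M * ‖R Complex.I v‖ ^ 2)
        = ENNReal.ofReal (√(2 * M) * ‖R Complex.I v‖) ^ 2 := by
      rw [← ENNReal.ofReal_pow (by positivity), mul_pow, Real.sq_sqrt (by positivity)]
    rw [h2] at h1
    exact (ENNReal.pow_le_pow_left_iff two_ne_zero).1 h1
  have hmem : ∀ v, MemLp (fun t => B (U t v)) 2 volume := fun v =>
    ⟨(B.continuous.comp (S.cont v)).aestronglyMeasurable,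
      (hest v).trans_lt ENNReal.ofReal_lt_top⟩
  have hnorm : ∀ v, ‖(hmem v).toLp _‖ ≤ √(2 * M) * ‖R Complex.I v‖ := by
    intro v
    rw [Lp.norm_toLp]
    exact ENNReal.toReal_le_of_le_ofReal (by positivity) (hest v)
  -- approximating sequence
  obtain ⟨x, hxmem, hxlim⟩ := mem_closure_iff_seq_limit.1 (S.dense u₀)
  set v : ℕ → ℋ := fun n => H ⟨x n, hxmem n⟩ - Complex.I • x n with hv
  have hRv : ∀ n, R Complex.I (v n) = x n := fun n => S.inv Complex.I hI ⟨x n, hxmem n⟩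
  set F : ℕ → Lp 𝒦 2 (volume : Measure ℝ) := fun n => (hmem (v n)).toLp _ with hF
  have hdist : ∀ n m, dist (F n) (F m) ≤ √(2 * M) * dist (x n) (x m) := by
    intro n m
    rw [dist_eq_norm, dist_eq_norm, ← hRv n, ← hRv m, ← map_sub]
    refine le_trans (le_of_eq ?_) (hnorm (v n - v m))
    congr 1
    simp only [hF]
    rw [← MemLp.toLp_sub]
    congr 1
    ext t
    simp
  have hcau : CauchySeq F := by
    have hxc := hxlim.cauchySeq
    rw [Metric.cauchySeq_iff] at hxc ⊢
    intro ε hε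
    have hpos : 0 < √(2 * M) + 1 := by positivity
    obtain ⟨N, hN⟩ := hxc (ε / (√(2 * M) + 1)) (by positivity)
    refine ⟨N, fun m hm n hn => ?_⟩
    have h1 := hN m hm n hn
    rw [lt_div_iff₀ hpos] at h1
    have h2 := hdist m n
    nlinarith [dist_nonneg (x := x m) (y := x n)]
  obtain ⟨G, hG⟩ := cauchySeq_tendsto_of_complete hcau
  refine ⟨G, ?_, ?_⟩
  · refine le_of_tendsto_of_tendsto' hG.norm (hxlim.norm.const_mul (√(2 * M))) fun n => ?_
    have := hnorm (v n)
    rwa [hRv] at this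
  · obtain ⟨ns, hns, hae⟩ := (tendstoInMeasure_of_tendsto_Lp hG).exists_seq_tendsto_ae
    have hall : ∀ᵐ t : ℝ, ∀ n, F n t = B (U t (v n)) :=
      ae_all_iff.2 fun n => (hmem (v n)).coeFn_toLp
    filter_upwards [hae, hall] with t ht1 ht2
    have hgr : ∀ n, (U t (x n), F n t) ∈ A.graph := by
      intro n
      rw [ht2, hBv]
      have e : U t (x n) = R Complex.I (U t (v n)) := by
        rw [← S.commU hI, hRv]
      rw [e]
      exact A.mem_graph ⟨R Complex.I (U t (v n)), (dom hI _).1⟩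
    have hlim : Tendsto (fun k => (U t (x (ns k)), F (ns k) t)) atTop (𝓝 (U t u₀, G t)) := by
      refine Tendsto.prodMk_nhds ?_ ht1
      exact ((U t).continuous.tendsto u₀).comp (hxlim.comp hns.tendsto_atTop)
    exact hAclosed.mem_of_tendsto hlim (Eventually.of_forall fun k => hgr _)

end Setup

end KatoAux

/-- Kato's smooth perturbation theory, Reed–Simon Thm XIII.25:
if `H` is self-adjoint on `ℋ` (given together with its resolvent family `R z = (H-z)⁻¹` and
its unitary group `U t = e^{-itH}`), `A` is a closed densely defined operator from `ℋ` to `𝒦`,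
and `sup_{z∉ℝ} ‖A (H-z)⁻¹ A*‖ ≤ M` (stated in the weak sense via the adjoint `A*`),
then `∫ ‖A e^{-itH} u₀‖² dt ≤ C ‖u₀‖²`. -/
theorem stmt2 {ℋ 𝒦 : Type*}
    [NormedAddCommGroup ℋ] [InnerProductSpace ℂ ℋ] [CompleteSpace ℋ]
    [NormedAddCommGroup 𝒦] [InnerProductSpace ℂ 𝒦] [CompleteSpace 𝒦]
    -- a self-adjoint operator `H` on `ℋ`
    (H : ℋ →ₗ.[ℂ] ℋ) (hH : IsSelfAdjoint H)
    -- its resolvent family `R z = (H - z)⁻¹` for non-real `z`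
    (R : ℂ → ℋ →L[ℂ] ℋ)
    (hRmem : ∀ z : ℂ, z.im ≠ 0 → ∀ u : ℋ, R z u ∈ H.domain)
    (hReq : ∀ (z : ℂ) (hz : z.im ≠ 0) (u : ℋ), H ⟨R z u, hRmem z hz u⟩ - z • R z u = u)
    (hRinv : ∀ (z : ℂ), z.im ≠ 0 → ∀ u : H.domain, R z (H u - z • (u : ℋ)) = u)
    -- the strongly continuous unitary group `U t = e^{-itH}` generated by `H`
    (U : ℝ → ℋ →L[ℂ] ℋ)
    (hU0 : U 0 = ContinuousLinearMap.id ℂ ℋ)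
    (hUadd : ∀ s t : ℝ, U (s + t) = (U s).comp (U t))
    (hUiso : ∀ (t : ℝ) (u : ℋ), ‖U t u‖ = ‖u‖)
    (hUgen : ∀ u : H.domain, ∀ t : ℝ,
      HasDerivAt (fun τ : ℝ => U τ (u : ℋ)) (-(Complex.I • U t (H u))) t)
    -- `A` closed and densely defined from `ℋ` to `𝒦`
    (A : ℋ →ₗ.[ℂ] 𝒦) (hAdense : Dense (A.domain : Set ℋ)) (hAclosed : A.IsClosed)
    -- `A` is `H`-supersmooth
    (M : ℝ)
    (hsmooth : ∀ z : ℂ, z.im ≠ 0 → ∀ f g : A.adjoint.domain,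
      ‖(⟪R z (A.adjoint f), (A.adjoint g : ℋ)⟫_ℂ : ℂ)‖ ≤ M * ‖(f : 𝒦)‖ * ‖(g : 𝒦)‖) :
    ∃ C : ℝ, 0 < C ∧ ∀ u₀ : ℋ,
      (∀ᵐ t : ℝ, U t u₀ ∈ A.domain) ∧
      ∫⁻ t : ℝ, (if h : U t u₀ ∈ A.domain then (‖A ⟨U t u₀, h⟩‖₊ : ℝ≥0∞) ^ 2 else 0) ≤
        ENNReal.ofReal (C * ‖u₀‖ ^ 2) := by
  have S : KatoAux.Setup H R U := by
    have hd := hH.dense_domain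
    refine ⟨?_, hd, hRmem, hReq, hRinv, hU0, hUadd, hUiso, hUgen⟩
    intro x y
    have h := LinearPMap.adjoint_isFormalAdjoint hd
    rw [LinearPMap.isSelfAdjoint_def.1 hH] at h
    exact h x y
  set M' := max M 0 with hM'
  have hM0 : 0 ≤ M' := le_max_right _ _
  refine ⟨2 * M' + 1, by positivity, fun u₀ => ?_⟩
  obtain ⟨F, hFn, hF⟩ := S.final A hAdense hAclosed M' hM0 (fun z hz f g =>
    (hsmooth z hz f g).trans (by gcongr; exact le_max_left _ _)) u₀
  have hval : ∀ᵐ t : ℝ, ∃ h : U t u₀ ∈ A.domain, A ⟨U t u₀, h⟩ = F t := by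
    filter_upwards [hF] with t ht
    obtain ⟨y, hy1, hy2⟩ := (LinearPMap.mem_graph_iff A).1 ht
    simp only at hy1 hy2
    have hm : U t u₀ ∈ A.domain := hy1 ▸ y.2
    refine ⟨hm, ?_⟩
    rw [← hy2]
    congr 1
    exact Subtype.ext hy1.symm
  refine ⟨hval.mono fun t ht => ht.1, ?_⟩
  have e : ∫⁻ t : ℝ, (if h : U t u₀ ∈ A.domain then (‖A ⟨U t u₀, h⟩‖₊ : ℝ≥0∞) ^ 2 else 0)
      = ∫⁻ t : ℝ, ‖F t‖ₑ ^ 2 := by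
    apply lintegral_congr_ae
    filter_upwards [hval] with t ht
    obtain ⟨h, hh⟩ := ht
    rw [dif_pos h, hh]
    rfl
  rw [e, KatoAux.lintegral_sq]
  have h1 : eLpNorm F 2 volume = ENNReal.ofReal ‖F‖ := by
    rw [Lp.norm_def, ENNReal.ofReal_toReal (Lp.eLpNorm_ne_top F)]
  rw [h1, ← ENNReal.ofReal_pow (norm_nonneg _)]
  apply ENNReal.ofReal_le_ofReal
  calc ‖F‖ ^ 2 ≤ (√(2 * M') * ‖u₀‖) ^ 2 := by gcongr
    _ = 2 * M' * ‖u₀‖ ^ 2 := by rw [mul_pow, Real.sq_sqrt (by positivity)]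
    _ ≤ (2 * M' + 1) * ‖u₀‖ ^ 2 := by gcongr; linarith
end
end
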